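/- Let φ: S → R be a ring morphism, W ∈ S, and (X,d) a finite rank matrix factorisation of φ(W) over R with fixed homogeneous basis. Let t = (t₁,…,tₙ) be a quasi-regular sequence in R, λⱼ odd R-linear maps on X with λⱼd + dλⱼ = tⱼ·1_X, and suppose given a deformation retract datum of ℤ-graded complexes over S: σ: (R/tR,0) → (K(t),δ), R-linear augmentation π: K(t) → R/tR, S-linear homotopy h with h² = 0, hσ = 0, πh = 0. Define ψ = ε∘σ_∞ : X/tX → X[n] where σ_∞ = Σ_{m≥0}(hd)^m σ, ε the signed projection onto X·dt₁⋯dtₙ, and θ = (−1)^n λ₁⋯λₙ : X[n] → X/tX. Then ψ∘θ is homotopic to the identity of X[n] over S (so φ_*(X)[n] is a direct summand of X/tX in the homotopy category of linear factorisations of W over S), and the idempotent e = θ∘ψ equals (−1)^n λ₁⋯λₙ ε (hd)^n σ. -/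

import Mathlib

/-!
STATEMENT 4.

Conventions as in the previous statements.  A finite rank matrix factorisation `X` of
`φ(W)` over `R` with a fixed homogeneous basis is `ι → R` with parity `par`; grading
involution `gX`, `d² = φ(W)·1`.  The Koszul complex `K(t)` on `u : Fin n → R` is
`Finset (Fin n) → R` with contraction differential `δ = delK u`, and
`X ⊗ K(t) ≅ ι → K(t)`, `X/tX ≅ ι → R/tR`.  The signed projection
`ε : X ⊗ K(t) → X[n]`, `ε(x·dt₁⋯dtₙ) = (-1)^{n|x|}x`, is `gXⁿ` composed with the
projection to the top component.  `σ_∞ = Σ_{m≥0}(hd)^m σ` is the finite sum over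
`m ≤ n` (higher terms vanish for degree reasons), `ψ = ε ∘ σ_∞` and
`θ = (-1)ⁿ λ₁⋯λₙ : X[n] → X/tX` (composition with reduction mod `t`).  The suspension
`X[n]` carries the grading `(-1)ⁿ gX` and the differential `(-1)ⁿ d`.  Quasi-regularity
is the classical coefficient condition.
-/

namespace Stmt4

open Finset

def IsQuasiRegular {R : Type*} [CommRing R] {n : ℕ} (u : Fin n → R) : Prop :=
  ∀ (k : ℕ) (F : MvPolynomial (Fin n) R), F.IsHomogeneous k →
    MvPolynomial.eval u F ∈ (Ideal.span (Set.range u)) ^ (k + 1) →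
    ∀ m, MvPolynomial.coeff m F ∈ Ideal.span (Set.range u)

abbrev KT (R : Type*) (n : ℕ) := Finset (Fin n) → R

def ksign (R : Type*) [CommRing R] {n : ℕ} (i : Fin n) (I : Finset (Fin n)) : R :=
  (-1 : R) ^ (I.filter (fun j => j < i)).card

def delK {R : Type*} [CommRing R] {n : ℕ} (u : Fin n → R) : Module.End R (KT R n) :=
  LinearMap.pi fun J =>
    ∑ i : Fin n,
      if i ∈ J then 0
      else (ksign R i J * u i) • LinearMap.proj (insert i J)

def gX (R : Type*) [CommRing R] {ι : Type*} [Fintype ι] [DecidableEq ι]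
    (par : ι → Bool) : Module.End R (ι → R) :=
  LinearMap.pi fun i => (if par i then (-1 : R) else 1) • LinearMap.proj i

def dmat {R : Type*} [CommRing R] {ι : Type*} [Fintype ι] [DecidableEq ι]
    (d : Module.End R (ι → R)) (a b : ι) : R :=
  d (Pi.single b 1) a

def matExt {R M : Type*} [CommRing R] [AddCommGroup M] [Module R M]
    {ι : Type*} [Fintype ι] [DecidableEq ι] (A : ι → ι → R) :
    (ι → M) →ₗ[R] (ι → M) :=
  LinearMap.pi fun a => ∑ b, A a b • LinearMap.proj b

def evExt (S : Type*) [CommRing S] {L M : Type*} [AddCommGroup L] [Module S L]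
    [AddCommGroup M] [Module S M] {ι : Type*} (t : L →ₗ[S] M) :
    (ι → L) →ₗ[S] (ι → M) :=
  LinearMap.pi fun i => t ∘ₗ LinearMap.proj i

def oddExt (S : Type*) [CommRing S] {L M : Type*} [AddCommGroup L] [Module S L]
    [AddCommGroup M] [Module S M] {ι : Type*} (par : ι → Bool) (t : L →ₗ[S] M) :
    (ι → L) →ₗ[S] (ι → M) :=
  LinearMap.pi fun i =>
    (if par i then (-1 : ℤ) else 1) • (t ∘ₗ LinearMap.proj i)

/-- The signed projection `ε : X ⊗ K(t) → X[n]`. -/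
def epsX (R : Type*) [CommRing R] {ι : Type*} [Fintype ι] [DecidableEq ι]
    (par : ι → Bool) (n : ℕ) : (ι → KT R n) →ₗ[R] (ι → R) :=
  ((gX R par) ^ n) ∘ₗ
    (LinearMap.pi fun i =>
      (LinearMap.proj (univ : Finset (Fin n)) : KT R n →ₗ[R] R) ∘ₗ LinearMap.proj i)


section Perturbation

variable {A : Type*} [Ring A]

theorem list_prod_anticomm (R : Type*) [CommRing R] [Algebra R A] {l : List A} {d : A}
    (hl : ∀ x ∈ l, d * x = -(x * d)) :
    d * l.prod = (-1 : R) ^ l.length • (l.prod * d) := by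
  induction l with
  | nil => simp
  | cons a l ih =>
    have h1 := ih fun x hx => hl x (List.mem_cons_of_mem _ hx)
    have h2 := hl a List.mem_cons_self
    rw [List.prod_cons, List.length_cons, ← mul_assoc, h2, neg_mul, mul_assoc, h1,
      mul_smul_comm, pow_succ, mul_neg_one, neg_smul, mul_assoc]

theorem pow_anticomm (R : Type*) [CommRing R] [Algebra R A] {x d : A} (hx : d * x = -(x * d))
    (n : ℕ) : d * x ^ n = (-1 : R) ^ n • (x ^ n * d) := by
  simpa using list_prod_anticomm R (l := List.replicate n x) (d := d)
    fun y hy => by rw [List.eq_of_mem_replicate hy, hx]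

theorem anticomm_of_commute_relations {E L G V w : A} (hEG : E * G = -(G * E))
    (hLG : L * G = -(G * L)) (hGG : G * G = 1) (hGV : G * V = V * G) (hGw : G * w = w * G)
    (hLV : L * V = V * L) (hEw : E * w = w * E) (hsum : V * w + w * V = L * E + E * L) :
    (E + G * V) * (G * w - L) = -((G * w - L) * (E + G * V)) := by
  have a1 : E * G * w = -(G * w * E) := by rw [hEG, neg_mul, mul_assoc, hEw, mul_assoc]
  have a2 : L * G * V = -(G * V * L) := by rw [hLG, neg_mul, mul_assoc, hLV, mul_assoc]
  have a3 : G * V * G * w = V * w := by rw [hGV, mul_assoc V, hGG, mul_one]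
  have a4 : G * w * G * V = w * V := by rw [hGw, mul_assoc w, hGG, mul_one]
  rw [eq_neg_iff_add_eq_zero]
  calc (E + G * V) * (G * w - L) + (G * w - L) * (E + G * V)
      = (E * G * w + G * w * E) - (L * G * V + G * V * L) + (G * V * G * w + G * w * G * V)
          - (L * E + E * L) := by noncomm_ring
    _ = 0 := by rw [a1, a2, a3, a4, hsum]; abel

/-- The homotopy of the perturbation lemma for a strong deformation retract. -/
theorem perturbation_homotopy {H d δ p : A} {n : ℕ} (hnil : (H * d) ^ (n + 1) = 0)
    (hHH : H * H = 0) (hpH : p * d * H = 0) (hδd : δ * d = -(d * δ))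
    (hdd : H * (d * d) = d * d * H) (hp : p = 1 + (δ * H + H * δ)) :
    (∑ m ∈ range (n + 1), (H * d) ^ m) * p - 1 =
      (d + δ) * ((∑ m ∈ range (n + 1), (H * d) ^ m) * H) +
        (∑ m ∈ range (n + 1), (H * d) ^ m) * H * (d + δ) := by
  set T := ∑ m ∈ range (n + 1), (H * d) ^ m with hT
  have h1 : (1 - H * d) * T = 1 := by rw [hT, mul_neg_geom_sum, hnil, sub_zero]
  have h2 : T * (1 - H * d) = 1 := by rw [hT, geom_sum_mul_neg, hnil, sub_zero]
  have hHT : H * T = H := by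
    calc H * T = H * (1 - H * d) * T := by
          rw [mul_sub, ← mul_assoc, hHH]; simp
      _ = H := by rw [mul_assoc, h1, mul_one]
  have hTH : T * H = H + H * d * (T * H) := by
    have : (1 - H * d) * T * H = H := by rw [h1, one_mul]
    rw [mul_assoc, sub_mul, one_mul] at this
    exact eq_add_of_sub_eq this
  have hpT : p * d * (T * H) = 0 := by
    calc p * d * (T * H) = p * d * H * (1 + d * (T * H)) := by
          conv_lhs => rw [hTH]
          noncomm_ring
      _ = 0 := by rw [hpH, zero_mul]
  have hHTH : H * (T * H) = 0 := by rw [← mul_assoc, hHT, hHH]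
  have hHddT : H * (d * d) * (T * H) = 0 := by
    rw [hdd, mul_assoc, hHTH, mul_zero]
  have key : (1 - H * d) * ((d + δ) * (T * H)) = δ * H := by
    have e1 : H * d * δ = -(H * δ * d) := by
      rw [mul_assoc, mul_assoc, hδd, mul_neg, neg_neg]
    have e2 : H * δ = p - 1 - δ * H := by rw [hp]; abel
    calc (1 - H * d) * ((d + δ) * (T * H))
        = (d + δ) * (T * H) - H * (d * d) * (T * H) - H * d * δ * (T * H) := by noncomm_ring
      _ = (d + δ) * (T * H) + (p - 1 - δ * H) * d * (T * H) := by
          rw [hHddT, e1, e2]; noncomm_ring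
      _ = p * d * (T * H) + δ * (T * H - H * d * (T * H)) := by noncomm_ring
      _ = δ * H := by rw [hpT, zero_add, sub_eq_of_eq_add hTH]
  have inj : ∀ x y : A, (1 - H * d) * x = (1 - H * d) * y → x = y := fun x y hxy => by
    rw [← one_mul x, ← h2, mul_assoc, hxy, ← mul_assoc, h2, one_mul]
  apply inj
  rw [mul_add, key, mul_sub, ← mul_assoc, h1, mul_assoc T, ← mul_assoc _ T, h1, hp]
  noncomm_ring

/-- The perturbed inclusion of the perturbation lemma is a chain map. -/
theorem perturbation_inclusion {S M N : Type*} [CommRing S] [AddCommGroup M] [Module S M]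
    [AddCommGroup N] [Module S N] {H d δ : Module.End S M} {dN : Module.End S N}
    {i : N →ₗ[S] M} {q : M →ₗ[S] N} {n : ℕ} (hnil : (H * d) ^ (n + 1) = 0)
    (hHH : H * H = 0) (hHi : H ∘ₗ i = 0) (hqH : q ∘ₗ H = 0) (hqi : q ∘ₗ i = LinearMap.id)
    (hδi : δ ∘ₗ i = 0) (hqd : q ∘ₗ d = dN ∘ₗ q) (hδd : δ * d = -(d * δ))
    (hdd : H * (d * d) = d * d * H) (hp : i ∘ₗ q = 1 + (δ * H + H * δ)) :
    (d + δ) ∘ₗ (∑ m ∈ range (n + 1), (H * d) ^ m) ∘ₗ i =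
      ((∑ m ∈ range (n + 1), (H * d) ^ m) ∘ₗ i) ∘ₗ dN := by
  set T := ∑ m ∈ range (n + 1), (H * d) ^ m with hT
  have h1 : (1 - H * d) * T = 1 := by rw [hT, mul_neg_geom_sum, hnil, sub_zero]
  have h2 : T * (1 - H * d) = 1 := by rw [hT, geom_sum_mul_neg, hnil, sub_zero]
  have hTx : ∀ x, T x = x + H (d (T x)) := fun x => by
    have := LinearMap.congr_fun h1 x
    simp only [Module.End.mul_apply, LinearMap.sub_apply, Module.End.one_apply] at this
    exact eq_add_of_sub_eq this
  have inj : ∀ x y : M, x - H (d x) = y - H (d y) → x = y := fun x y hxy => by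
    have hx := LinearMap.congr_fun h2 x
    have hy := LinearMap.congr_fun h2 y
    simp only [Module.End.mul_apply, LinearMap.sub_apply, Module.End.one_apply] at hx hy
    rw [← hx, hxy, hy]
  have cHH : ∀ x, H (H x) = 0 := fun x => LinearMap.congr_fun hHH x
  have cHi : ∀ x, H (i x) = 0 := fun x => LinearMap.congr_fun hHi x
  have cqH : ∀ x, q (H x) = 0 := fun x => LinearMap.congr_fun hqH x
  have cqi : ∀ x, q (i x) = x := fun x => LinearMap.congr_fun hqi x
  have cδi : ∀ x, δ (i x) = 0 := fun x => LinearMap.congr_fun hδi x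
  have cqd : ∀ x, q (d x) = dN (q x) := fun x => LinearMap.congr_fun hqd x
  have cδd : ∀ x, δ (d x) = -(d (δ x)) := fun x => LinearMap.congr_fun hδd x
  have cdd : ∀ x, H (d (d x)) = d (d (H x)) := fun x => LinearMap.congr_fun hdd x
  have cp : ∀ x, i (q x) = x + (δ (H x) + H (δ x)) := fun x => LinearMap.congr_fun hp x
  ext x
  set y := T (i x) with hy
  have y1 : y = i x + H (d y) := hTx (i x)
  have y2 : H y = 0 := by rw [y1, map_add, cHi, cHH, add_zero]
  have y3 : q y = x := by rw [y1, map_add, cqi, cqH, add_zero]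
  have y4 : δ y = δ (H (d y)) := by conv_lhs => rw [y1, map_add, cδi, zero_add]
  have y5 : H (d (d y)) = 0 := by rw [cdd, y2, map_zero, map_zero]
  have y6 : i (dN x) = d y + (δ (H (d y)) + H (δ (d y))) := by
    rw [← cp, cqd, y3]
  change d y + δ y = T (i (dN x))
  apply inj
  rw [sub_eq_of_eq_add (hTx (i (dN x))), y6, cδd, map_add, map_add, y5, zero_add, ← y4, map_neg]
  abel

end Perturbation

section Extension

variable {R : Type*} [CommRing R] {ι : Type*} [Fintype ι] [DecidableEq ι]

theorem matExt_apply {M : Type*} [AddCommGroup M] [Module R M] (A : ι → ι → R) (f : ι → M)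
    (a : ι) : matExt A f a = ∑ b, A a b • f b := by
  simp [matExt]

theorem apply_eq_sum_dmat (d : Module.End R (ι → R)) (f : ι → R) (a : ι) :
    d f a = ∑ b, dmat d a b * f b := by
  conv_lhs => rw [pi_eq_sum_univ' f]
  simp [dmat, Finset.sum_apply, mul_comm]

/-- Base extension `d ↦ d ⊗ 1` from `X` to `X ⊗ M`, in coordinates. -/
def extHom (M : Type*) [AddCommGroup M] [Module R M] :
    Module.End R (ι → R) →ₐ[R] Module.End R (ι → M) :=
  AlgHom.ofLinearMap
    { toFun := fun d => matExt (dmat d)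
      map_add' := fun d e => by
        ext1 a; ext b c
        simp [matExt_apply, dmat, add_smul, sum_add_distrib]
      map_smul' := fun r d => by
        ext1 a; ext b c
        simp [matExt_apply, dmat, mul_smul, smul_sum] }
    (by
      ext1 a; ext b c
      simp [matExt_apply, dmat, Pi.single_apply])
    (fun d e => by
      refine LinearMap.ext fun f => funext fun a => ?_
      have : ∀ c, dmat (d * e) a c = ∑ b, dmat d a b * dmat e b c := fun c => by
        rw [dmat, Module.End.mul_apply, apply_eq_sum_dmat d]; rfl
      simp only [LinearMap.coe_mk, AddHom.coe_mk, Module.End.mul_apply, matExt_apply, this,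
        sum_smul, smul_sum, mul_smul]
      exact sum_comm)

theorem extHom_apply {M : Type*} [AddCommGroup M] [Module R M] (d : Module.End R (ι → R))
    (f : ι → M) (a : ι) : extHom M d f a = ∑ b, dmat d a b • f b :=
  matExt_apply _ _ _

theorem extHom_self (d : Module.End R (ι → R)) : extHom R d = d :=
  LinearMap.ext fun f => funext fun a => by
    rw [extHom_apply, apply_eq_sum_dmat]; rfl

theorem extHom_comp_evExt {L M : Type*} [AddCommGroup L] [Module R L] [AddCommGroup M]
    [Module R M] (d : Module.End R (ι → R)) (t : L →ₗ[R] M) :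
    extHom M d ∘ₗ evExt R t = evExt R t ∘ₗ extHom L d :=
  LinearMap.ext fun f => funext fun a => by
    simp [extHom_apply, evExt]

theorem extHom_gX {M : Type*} [AddCommGroup M] [Module R M] (par : ι → Bool) (f : ι → M)
    (a : ι) : extHom M (gX R par) f a = (if par a then (-1 : ℤ) else 1) • f a := by
  have key : ∀ b, dmat (gX R par) a b = (if par a then (-1 : R) else 1) * if a = b then 1 else 0 :=
    fun b => by simp only [dmat, gX, LinearMap.pi_apply, LinearMap.smul_apply,
      LinearMap.proj_apply, smul_eq_mul, Pi.single_apply]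
  rw [extHom_apply]
  simp only [key, mul_smul, ← smul_sum]
  cases par a <;> simp

theorem gX_mul_self (par : ι → Bool) : gX R par * gX R par = 1 := by
  refine LinearMap.ext fun f => funext fun a => ?_
  cases h : par a <;> simp [gX, h]

end Extension

section Koszul

variable {R : Type*} [CommRing R] {n : ℕ}

theorem delK_apply (u : Fin n → R) (f : KT R n) (J : Finset (Fin n)) :
    delK u f J = ∑ i, if i ∈ J then 0 else ksign R i J * u i * f (insert i J) := by
  simp only [delK, LinearMap.pi_apply, LinearMap.sum_apply]
  refine sum_congr rfl fun i _ => ?_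
  split_ifs <;> simp

theorem ksign_mul_self (i : Fin n) (I : Finset (Fin n)) : ksign R i I * ksign R i I = 1 := by
  rw [ksign, ← mul_pow]; simp

theorem ksign_insert {i j : Fin n} {I : Finset (Fin n)} (hj : j ∉ I) :
    ksign R i (insert j I) = (if j < i then -1 else 1) * ksign R i I := by
  rw [ksign, ksign, filter_insert]
  split_ifs with h
  · rw [card_insert_of_notMem (by simp [hj]), pow_succ]; ring
  · simp

theorem ksign_swap {i j : Fin n} {I : Finset (Fin n)} (hij : i ≠ j) (hi : i ∉ I) (hj : j ∉ I) :
    ksign R i (insert j I) * ksign R j (insert i I) = -(ksign R j I * ksign R i I) := by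
  rw [ksign_insert hi, ksign_insert hj]
  rcases lt_or_gt_of_ne hij with h | h
  · rw [if_neg h.not_gt, if_pos h]; ring
  · rw [if_pos h, if_neg h.not_gt]; ring

/-- Left exterior multiplication by the `j`-th basis vector of the Koszul complex. -/
def wedgeK (R : Type*) [CommRing R] {n : ℕ} (j : Fin n) : Module.End R (KT R n) :=
  LinearMap.pi fun J => if j ∈ J then ksign R j (J.erase j) • LinearMap.proj (J.erase j) else 0

theorem wedgeK_apply (j : Fin n) (f : KT R n) (J : Finset (Fin n)) :
    wedgeK R j f J = if j ∈ J then ksign R j (J.erase j) * f (J.erase j) else 0 := by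
  simp only [wedgeK, LinearMap.pi_apply]
  split_ifs <;> simp

theorem delK_wedgeK (u : Fin n → R) (j : Fin n) :
    delK u * wedgeK R j + wedgeK R j * delK u = u j • 1 := by
  refine LinearMap.ext fun f => funext fun J => ?_
  simp only [LinearMap.add_apply, Module.End.mul_apply, Pi.add_apply, LinearMap.smul_apply,
    Module.End.one_apply, Pi.smul_apply, smul_eq_mul, wedgeK_apply j (delK u f)]
  by_cases hj : j ∈ J
  · obtain ⟨I, hI, rfl⟩ : ∃ I, j ∉ I ∧ J = insert j I :=
      ⟨J.erase j, notMem_erase _ _, (insert_erase hj).symm⟩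
    rw [if_pos hj, erase_insert hI, delK_apply, delK_apply, mul_sum, ← sum_add_distrib,
      sum_eq_single j]
    · simp only [mem_insert_self, if_true, hI, if_false, zero_add]
      linear_combination (u j * f (insert j I)) * ksign_mul_self (R := R) j I
    · intro i _ hij
      by_cases hi : i ∈ I
      · simp [hi]
      · have e : (insert i (insert j I)).erase j = insert i I := by
          rw [insert_comm, erase_insert]
          simp [hI, hij.symm]
        rw [if_neg (by simp [hi, hij]), if_neg hi, wedgeK_apply, if_pos (by simp), e]
        linear_combination (u i * f (insert i I)) * ksign_swap (R := R) hij hi hI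
    · simp
  · rw [if_neg hj, add_zero, delK_apply, sum_eq_single j]
    · rw [if_neg hj, wedgeK_apply, if_pos (mem_insert_self _ _), erase_insert hj]
      linear_combination (u j * f J) * ksign_mul_self (R := R) j J
    · intro i _ hij
      split_ifs
      · rfl
      · rw [wedgeK_apply, if_neg (by simp [hj, hij.symm]), mul_zero]
    · simp

theorem map_eq_zero_of_card_lt {S : Type*} [CommRing S] [Algebra S R] {h : KT R n →ₗ[S] KT R n}
    (hh_deg : ∀ (kk : ℕ) (f : KT R n), (∀ I, I.card ≠ kk → f I = 0) →
      ∀ J, J.card ≠ kk + 1 → h f J = 0)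
    {k : ℕ} {f : KT R n} (hf : ∀ I, I.card < k → f I = 0) (J : Finset (Fin n))
    (hJ : J.card < k + 1) : h f J = 0 := by
  have hsum : f = ∑ m ∈ range (n + 1), fun I => if I.card = m then f I else 0 := by
    ext I
    have : I.card ∈ range (n + 1) := by
      simpa [Nat.lt_succ_iff] using card_le_univ I
    simp only [Finset.sum_apply, sum_ite_eq, this, if_true]
  rw [hsum, map_sum, Finset.sum_apply]
  refine sum_eq_zero fun m _ => ?_
  by_cases hm : J.card = m + 1
  · have : (fun I : Finset (Fin n) => if I.card = m then f I else 0) = 0 := by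
      ext I
      simp only [Pi.zero_apply, ite_eq_right_iff]
      exact fun hI => hf I (by omega)
    rw [this, map_zero, Pi.zero_apply]
  · exact hh_deg m _ (fun I hI => if_neg hI) J hm

end Koszul

section Tensor

variable {S R : Type*} [CommRing S] [CommRing R] {n : ℕ} {ι : Type*} [Fintype ι]
  [DecidableEq ι]

theorem evExt_extHom_gX {L M : Type*} [AddCommGroup L] [Module S L] [Module R L]
    [AddCommGroup M] [Module S M] [Module R M] (par : ι → Bool) (t : L →ₗ[S] M) (f : ι → L) :
    evExt S t (extHom L (gX R par) f) = extHom M (gX R par) (evExt S t f) :=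
  funext fun a => by
    simp only [evExt, LinearMap.pi_apply, LinearMap.comp_apply, LinearMap.proj_apply, extHom_gX,
      map_zsmul]

theorem oddExt_apply {L M : Type*} [AddCommGroup L] [Module S L]
    [AddCommGroup M] [Module S M] [Module R M] (par : ι → Bool) (t : L →ₗ[S] M) (f : ι → L) :
    oddExt S par t f = extHom M (gX R par) (evExt S t f) :=
  funext fun a => by
    simp only [evExt, oddExt, LinearMap.pi_apply, LinearMap.comp_apply, LinearMap.proj_apply,
      extHom_gX, LinearMap.smul_apply]

theorem extHom_KT_apply (d : Module.End R (ι → R)) (f : ι → KT R n) (a : ι)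
    (I : Finset (Fin n)) : extHom (KT R n) d f a I = d (fun b => f b I) a := by
  rw [extHom_apply, apply_eq_sum_dmat]
  simp [Finset.sum_apply]

theorem extHom_mul_evExt {M : Type*} [AddCommGroup M] [Module R M] (d : Module.End R (ι → R))
    (t : Module.End R M) :
    extHom M d * evExt R t = (evExt R t : Module.End R (ι → M)) * extHom M d :=
  extHom_comp_evExt d t

theorem epsX_comp_extHom {par : ι → Bool} {d : Module.End R (ι → R)}
    (hd_odd : d * gX R par = -(gX R par * d)) :
    epsX R par n ∘ₗ extHom (KT R n) d = ((-1 : R) ^ n • d) ∘ₗ epsX R par n := by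
  have h1 : epsX R par n = (gX R par ^ n) ∘ₗ evExt R (LinearMap.proj univ) := rfl
  have h2 : ((-1 : R) ^ n • d) * gX R par ^ n = gX R par ^ n * d := by
    rw [smul_mul_assoc, pow_anticomm R hd_odd, smul_smul, ← mul_pow]; simp
  rw [h1, LinearMap.comp_assoc, ← extHom_comp_evExt, extHom_self, ← LinearMap.comp_assoc,
    ← LinearMap.comp_assoc]
  exact congrArg (· ∘ₗ _) h2.symm

theorem epsX_delK (par : ι → Bool) (u : Fin n → R) (f : ι → KT R n) :
    epsX R par n (extHom (KT R n) (gX R par) (evExt R (delK u) f)) = 0 := by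
  have : (LinearMap.pi fun i => (LinearMap.proj (univ : Finset (Fin n)) : KT R n →ₗ[R] R) ∘ₗ
      LinearMap.proj i) (extHom (KT R n) (gX R par) (evExt R (delK u) f)) = (0 : ι → R) := by
    ext a
    simp [extHom_gX, evExt, delK_apply]
  rw [epsX, LinearMap.comp_apply, this, map_zero]

/-- The inclusion `R → K(u)` of the degree zero part. -/
abbrev unitK (R : Type*) [CommRing R] (n : ℕ) : R →ₗ[R] KT R n :=
  LinearMap.single R (fun _ => R) ∅

/-- The differential `d ⊗ 1 + 1 ⊗ δ` of `X ⊗ K(u)`. -/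
def koszulDiff (par : ι → Bool) (d : Module.End R (ι → R)) (u : Fin n → R) :
    Module.End R (ι → KT R n) :=
  extHom (KT R n) d + extHom (KT R n) (gX R par) * evExt R (delK u)

/-- Exterior multiplication by the `j`-th basis vector, corrected by the null-homotopy `e` so as
to anticommute with the differential of `X ⊗ K(u)`. -/
def wedgeSub (n : ℕ) (par : ι → Bool) (e : Module.End R (ι → R)) (j : Fin n) :
    Module.End R (ι → KT R n) :=
  extHom (KT R n) (gX R par) * evExt R (wedgeK R j) - extHom (KT R n) e

theorem koszulDiff_mul_wedgeSub {par : ι → Bool} {d e : Module.End R (ι → R)} {u : Fin n → R}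
    {j : Fin n} (hd_odd : d * gX R par = -(gX R par * d))
    (he_odd : e * gX R par = -(gX R par * e)) (he : e * d + d * e = u j • 1) :
    koszulDiff par d u * wedgeSub n par e j = -(wedgeSub n par e j * koszulDiff par d u) := by
  set E := extHom (KT R n) d with hE
  set L := extHom (KT R n) e with hL
  set G := extHom (KT R n) (gX R par) with hG
  set V : Module.End R (ι → KT R n) := evExt R (delK u) with hV
  set w : Module.End R (ι → KT R n) := evExt R (wedgeK R j) with hw
  have hEG : E * G = -(G * E) := by rw [hE, hG, ← map_mul, hd_odd, map_neg, map_mul]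
  have hLG : L * G = -(G * L) := by rw [hL, hG, ← map_mul, he_odd, map_neg, map_mul]
  have hGG : G * G = 1 := by rw [hG, ← map_mul, gX_mul_self, map_one]
  have hLE : L * E + E * L = u j • 1 := by
    rw [hL, hE, ← map_mul, ← map_mul, ← map_add, he, map_smul, map_one]
  have hVw : V * w + w * V = u j • 1 :=
    congrArg (fun t => (evExt R t : Module.End R (ι → KT R n))) (delK_wedgeK u j)
  have hGV : G * V = V * G := extHom_mul_evExt _ _
  have hGw : G * w = w * G := extHom_mul_evExt _ _
  have hLV : L * V = V * L := extHom_mul_evExt _ _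
  have hEw : E * w = w * E := extHom_mul_evExt _ _
  exact anticomm_of_commute_relations hEG hLG hGG hGV hGw hLV hEw (hVw.trans hLE.symm)

theorem koszulDiff_single {par : ι → Bool} {d : Module.End R (ι → R)} (u : Fin n → R)
    (x : ι → R) :
    koszulDiff par d u (evExt R (unitK R n) x) =
      evExt R (unitK R n) (d x) := by
  have h1 := LinearMap.congr_fun (extHom_comp_evExt d (unitK R n)) x
  have h2 : evExt R (delK u) (evExt R (unitK R n) x) =
      0 := by
    ext a I
    simp [evExt, delK_apply]
  rw [extHom_self] at h1
  rw [koszulDiff, LinearMap.add_apply, Module.End.mul_apply, h2, map_zero, add_zero]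
  exact h1

theorem wedgeSub_apply (par : ι → Bool) (e : Module.End R (ι → R)) (j : Fin n)
    (f : ι → KT R n) (a : ι) (I : Finset (Fin n)) :
    wedgeSub n par e j f a I = gX R par (fun b => wedgeK R j (f b) I) a -
      e (fun b => f b I) a := by
  rw [← extHom_KT_apply e, wedgeSub, LinearMap.sub_apply, Module.End.mul_apply, Pi.sub_apply,
    Pi.sub_apply, extHom_KT_apply _ (evExt R _ f)]
  rfl

/-- Leading term of an iterated product of corrected exterior multiplications. -/
theorem wedgeSub_prod_apply (par : ι → Bool) (lam : Fin n → Module.End R (ι → R))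
    {l : List (Fin n)} (hl : l.Pairwise (· < ·)) (x : ι → R) :
    (∀ I, ¬ I ⊆ l.toFinset → (fun a => (l.map fun j => wedgeSub n par (lam j) j).prod
        (evExt R (unitK R n) x) a I) = 0) ∧
      (fun a => (l.map fun j => wedgeSub n par (lam j) j).prod
        (evExt R (unitK R n) x) a l.toFinset) = (gX R par ^ l.length) x := by
  induction l with
  | nil =>
    refine ⟨fun I hI => ?_, ?_⟩
    · ext a
      simp only [List.toFinset_nil, subset_empty] at hI
      simp [evExt, hI]
    · ext a
      simp [evExt]
  | cons j l ih =>
    obtain ⟨hj, hl'⟩ := List.pairwise_cons.1 hl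
    obtain ⟨ih1, ih2⟩ := ih hl'
    set F := (l.map fun j => wedgeSub n par (lam j) j).prod
      (evExt R (unitK R n) x) with hF
    have hFc : ((j :: l).map fun j => wedgeSub n par (lam j) j).prod
        (evExt R (unitK R n) x) = wedgeSub n par (lam j) j F := by
      rw [List.map_cons, List.prod_cons, Module.End.mul_apply]
    have hjl : j ∉ l.toFinset := fun hm => (hj j (List.mem_toFinset.1 hm)).false
    rw [hFc]
    simp only [wedgeSub_apply, wedgeK_apply, List.toFinset_cons]
    refine ⟨fun I hI => ?_, ?_⟩
    · have h1 : (fun b => F b I) = 0 :=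
        ih1 I fun hs => hI (hs.trans (subset_insert _ _))
      have h2 : (fun b => F b (I.erase j)) = 0 := ih1 _ fun hs => hI (subset_insert_iff.2 hs)
      have h3 : (fun b => if j ∈ I then ksign R j (I.erase j) * F b (I.erase j) else 0) = 0 := by
        ext b
        rw [congrFun h2 b]; simp
      rw [h1, h3]
      ext a
      simp
    · have h1 : (fun b => F b (insert j l.toFinset)) = 0 :=
        ih1 _ fun hs => hjl (hs (mem_insert_self _ _))
      have hs : ksign R j l.toFinset = 1 := by
        rw [ksign, filter_eq_empty_iff.2, card_empty, pow_zero]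
        exact fun i hi => (hj i (List.mem_toFinset.1 hi)).not_gt
      simp only [mem_insert_self, if_true, erase_insert hjl, hs, one_mul, h1, ih2]
      ext a
      rw [List.length_cons, pow_succ', Module.End.mul_apply]
      simp

/-- The augmentation `K(u) → R/uR`. -/
abbrev augK (u : Fin n → R) : KT R n →ₗ[R] R ⧸ Ideal.span (Set.range u) :=
  Submodule.mkQ (Ideal.span (Set.range u)) ∘ₗ LinearMap.proj ∅

theorem augK_wedgeSub_prod (par : ι → Bool) (u : Fin n → R)
    (lam : Fin n → Module.End R (ι → R)) (l : List (Fin n)) (x : ι → R) :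
    evExt R (augK u) ((l.map fun j => wedgeSub n par (lam j) j).prod
        (evExt R (unitK R n) x)) =
      evExt R (Submodule.mkQ (Ideal.span (Set.range u)))
        (((-1 : R) ^ l.length • (l.map lam).prod) x) := by
  have hbase : (fun a => (l.map fun j => wedgeSub n par (lam j) j).prod
      (evExt R (unitK R n) x) a ∅) = ((-1 : R) ^ l.length • (l.map lam).prod) x := by
    induction l with
    | nil => ext a; simp [evExt]
    | cons j l ih =>
      simp only [List.map_cons, List.prod_cons, Module.End.mul_apply, wedgeSub_apply, ih]
      have h0 : (fun b => wedgeK R j ((l.map fun j => wedgeSub n par (lam j) j).prod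
          (evExt R (unitK R n) x) b) ∅) = 0 := by
        ext b
        simp [wedgeK_apply]
      rw [h0, map_zero]
      ext a
      simp [pow_succ]
  rw [← hbase]
  rfl

end Tensor

end Stmt4

open Stmt4 in
theorem statement4
    {S R : Type*} [CommRing S] [CommRing R] [Algebra S R] (W : S) {n : ℕ}
    {ι : Type*} [Fintype ι] [DecidableEq ι] (par : ι → Bool)
    (d : Module.End R (ι → R))
    (hd_odd : d * gX R par = -(gX R par * d))
    (hd_sq : d * d = algebraMap S R W • (1 : Module.End R (ι → R)))
    -- quasi-regular t = u, odd homotopies λⱼ with λⱼd + dλⱼ = tⱼ·1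
    (u : Fin n → R) (hqreg : IsQuasiRegular u)
    (lam : Fin n → Module.End R (ι → R))
    (hlam_odd : ∀ j, lam j * gX R par = -(gX R par * lam j))
    (hlam : ∀ j, lam j * d + d * lam j = u j • (1 : Module.End R (ι → R)))
    -- deformation retract datum (σ, π, h) of ℤ-graded complexes over S
    (σ : (R ⧸ Ideal.span (Set.range u)) →ₗ[S] KT R n)
    (h : KT R n →ₗ[S] KT R n)
    (hσ_deg : ∀ x I, I ≠ (∅ : Finset (Fin n)) → σ x I = 0)
    (hh_deg : ∀ (kk : ℕ) (f : KT R n), (∀ I, I.card ≠ kk → f I = 0) →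
      ∀ J, J.card ≠ kk + 1 → h f J = 0)
    (hπσ : ((Submodule.mkQ (Ideal.span (Set.range u))) ∘ₗ
        (LinearMap.proj (∅ : Finset (Fin n)) : KT R n →ₗ[R] R)).restrictScalars S ∘ₗ σ
      = LinearMap.id)
    (hσπ : σ ∘ₗ ((Submodule.mkQ (Ideal.span (Set.range u))) ∘ₗ
        (LinearMap.proj (∅ : Finset (Fin n)) : KT R n →ₗ[R] R)).restrictScalars S
      = LinearMap.id +
        ((delK u).restrictScalars S ∘ₗ h + h ∘ₗ (delK u).restrictScalars S))
    (hh2 : h ∘ₗ h = 0) (hhσ : h ∘ₗ σ = 0)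
    (hπh : ((Submodule.mkQ (Ideal.span (Set.range u))) ∘ₗ
        (LinearMap.proj (∅ : Finset (Fin n)) : KT R n →ₗ[R] R)).restrictScalars S ∘ₗ h
      = 0) :
    -- notations
    let Q := R ⧸ Ideal.span (Set.range u)
    let σinf : (ι → Q) →ₗ[S] (ι → KT R n) :=
      ∑ m ∈ Finset.range (n + 1),
        ((oddExt S par h *
          ((matExt (dmat d) : Module.End R (ι → KT R n)).restrictScalars S)) ^ m) ∘ₗ
          evExt S σ
    -- ψ = ε ∘ σ∞ : X/tX → X[n]
    let ψ : (ι → Q) →ₗ[S] (ι → R) := (epsX R par n).restrictScalars S ∘ₗ σinf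
    -- θ = (-1)ⁿ λ₁⋯λₙ : X[n] → X/tX  (reduction mod t after λ₁⋯λₙ)
    let θ : (ι → R) →ₗ[R] (ι → Q) :=
      evExt R (Submodule.mkQ (Ideal.span (Set.range u))) ∘ₗ
        (((-1 : R) ^ n) • ((List.ofFn lam).prod : Module.End R (ι → R)))
    let DQ : Module.End R (ι → Q) := matExt (dmat d)
    let GQ : Module.End R (ι → Q) := oddExt R par (LinearMap.id : Q →ₗ[R] Q)
    -- θ and ψ are morphisms of linear factorisations (X[n] has grading (-1)ⁿ gX and
    -- differential (-1)ⁿ d):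
    (GQ ∘ₗ θ = θ ∘ₗ (((-1 : R) ^ n) • gX R par)) ∧
    (DQ ∘ₗ θ = θ ∘ₗ (((-1 : R) ^ n) • d)) ∧
    ((((-1 : R) ^ n) • gX R par).restrictScalars S ∘ₗ ψ = ψ ∘ₗ GQ.restrictScalars S) ∧
    ((((-1 : R) ^ n) • d).restrictScalars S ∘ₗ ψ = ψ ∘ₗ DQ.restrictScalars S) ∧
    -- ψ ∘ θ is homotopic to the identity of X[n] over S …
    (∃ Hm : (ι → R) →ₗ[S] (ι → R),
      ψ ∘ₗ θ.restrictScalars S - LinearMap.id =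
        (((-1 : R) ^ n) • d).restrictScalars S ∘ₗ Hm +
          Hm ∘ₗ (((-1 : R) ^ n) • d).restrictScalars S) ∧
    -- … and the idempotent e = θ ∘ ψ equals (-1)ⁿ λ₁⋯λₙ ε (hd)ⁿ σ
    (θ.restrictScalars S ∘ₗ ψ =
      (evExt R (Submodule.mkQ (Ideal.span (Set.range u))) ∘ₗ
        (((-1 : R) ^ n) • ((List.ofFn lam).prod :
          Module.End R (ι → R)))).restrictScalars S ∘ₗ
      (epsX R par n).restrictScalars S ∘ₗ
      ((oddExt S par h *
        ((matExt (dmat d) : Module.End R (ι → KT R n)).restrictScalars S)) ^ n) ∘ₗ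
      evExt S σ) := by
  intro Q σinf ψ θ DQ GQ
  set H : Module.End S (ι → KT R n) := oddExt S par h with hH
  set D : Module.End S (ι → KT R n) :=
    (matExt (dmat d) : Module.End R (ι → KT R n)).restrictScalars S with hD
  set G := extHom (KT R n) (gX R par) with hG
  have cH : ∀ f, H f = G (evExt S h f) := fun f => oddExt_apply par h f
  have cHG : ∀ f, H (G f) = G (H f) := fun f => by
    rw [cH, cH, hG, evExt_extHom_gX]
  have cGG : ∀ f, G (G f) = f := fun f => by
    rw [← Module.End.mul_apply, hG, ← map_mul, gX_mul_self, map_one, Module.End.one_apply]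
  have cD : ∀ f, D f = extHom (KT R n) d f := fun f => rfl
  have cDG : ∀ f, D (G f) = -(G (D f)) := fun f => by
    rw [cD, cD, ← Module.End.mul_apply, hG, ← map_mul, hd_odd, map_neg, map_mul]; rfl
  have cDD : ∀ f, D (D f) = W • f := fun f => by
    rw [cD, cD, ← Module.End.mul_apply, ← map_mul, hd_sq, map_smul, map_one,
      LinearMap.smul_apply, Module.End.one_apply, algebraMap_smul]
  set δ : Module.End S (ι → KT R n) := (G * evExt R (delK u)).restrictScalars S with hδ
  have cδ : ∀ f, δ f = G (evExt R (delK u) f) := fun f => rfl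
  have cδ' : ∀ f, δ f = evExt R (delK u) (G f) := fun f => by rw [cδ, hG, evExt_extHom_gX]
  set i : (ι → Q) →ₗ[S] (ι → KT R n) := evExt S σ with hi
  set q : (ι → KT R n) →ₗ[S] (ι → Q) := (evExt R (augK u)).restrictScalars S with hq
  have hHH : H * H = 0 := LinearMap.ext fun f => by
    rw [Module.End.mul_apply, cH f, cHG, cH, cGG]
    exact funext fun a => LinearMap.congr_fun hh2 (f a)
  have hHi : H ∘ₗ i = 0 := LinearMap.ext fun f => by
    have : evExt S h (i f) = 0 := funext fun a => LinearMap.congr_fun hhσ (f a)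
    rw [LinearMap.comp_apply, cH, this, map_zero, LinearMap.zero_apply]
  have hqG : ∀ f, q (G f) = extHom Q (gX R par) (q f) := fun f =>
    evExt_extHom_gX par (augK u) f
  have hqH : q ∘ₗ H = 0 := LinearMap.ext fun f => by
    have : q (evExt S h f) = 0 := funext fun a => LinearMap.congr_fun hπh (f a)
    rw [LinearMap.comp_apply, cH, hqG, this, map_zero, LinearMap.zero_apply]
  have hqi : q ∘ₗ i = LinearMap.id :=
    LinearMap.ext fun f => funext fun a => LinearMap.congr_fun hπσ (f a)
  have hδi : δ ∘ₗ i = 0 := LinearMap.ext fun f => by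
    have : evExt R (delK u) (i f) = 0 := by
      ext a I
      refine (delK_apply u _ I).trans (Finset.sum_eq_zero fun j _ => ?_)
      rw [LinearMap.proj_apply, show i f a (insert j I) = 0 from hσ_deg _ _ (Finset.insert_ne_empty _ _)]
      simp
    rw [LinearMap.comp_apply, cδ, this, map_zero, LinearMap.zero_apply]
  have hqd : q ∘ₗ D = DQ.restrictScalars S ∘ₗ q := LinearMap.ext fun f =>
    (LinearMap.congr_fun (extHom_comp_evExt d (augK u)) f).symm
  have hδd : δ * D = -(D * δ) := LinearMap.ext fun f => by
    have h1 : extHom (KT R n) d (evExt R (delK u) f) = evExt R (delK u) (extHom (KT R n) d f) :=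
      LinearMap.congr_fun (extHom_comp_evExt d (delK u)) f
    rw [Module.End.mul_apply, LinearMap.neg_apply, Module.End.mul_apply, cδ f, cDG, neg_neg, cδ,
      cD, cD, h1]
  have hdd : H * (D * D) = D * D * H := LinearMap.ext fun f => by
    simp only [Module.End.mul_apply, cDD, map_smul]
  have hp : i ∘ₗ q = 1 + (δ * H + H * δ) := LinearMap.ext fun f => by
    have h1 : δ (H f) = evExt R (delK u) (evExt S h f) := by rw [cδ', cH, cGG]
    have h2 : H (δ f) = evExt S h (evExt R (delK u) f) := by rw [cδ, cHG, cH, cGG]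
    rw [LinearMap.add_apply, LinearMap.add_apply, Module.End.mul_apply, Module.End.mul_apply, h1,
      h2]
    exact funext fun a => LinearMap.congr_fun hσπ (f a)
  have hlow : ∀ m f a (I : Finset (Fin n)), I.card < m → ((H * D) ^ m) f a I = 0 := by
    intro m f
    induction m with
    | zero => intro a I hI; omega
    | succ m ih =>
      intro a I hI
      rw [pow_succ', Module.End.mul_apply, Module.End.mul_apply, cH, extHom_gX, Pi.smul_apply]
      have : evExt S h (D (((H * D) ^ m) f)) a I = 0 := by
        refine map_eq_zero_of_card_lt hh_deg (k := m) (fun J hJ => ?_) I hI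
        rw [LinearMap.proj_apply, cD, extHom_KT_apply, show (fun b => ((H * D) ^ m) f b J) = 0 from
          funext fun b => ih b J hJ, map_zero, Pi.zero_apply]
      rw [this, smul_zero]
  have hpure : ∀ m f a (I : Finset (Fin n)), I.card ≠ m → ((H * D) ^ m) (i f) a I = 0 := by
    intro m f
    induction m with
    | zero =>
      intro a I hI
      exact hσ_deg _ _ fun h0 => hI (by rw [h0, Finset.card_empty])
    | succ m ih =>
      intro a I hI
      rw [pow_succ', Module.End.mul_apply, Module.End.mul_apply, cH, extHom_gX, Pi.smul_apply]
      have : evExt S h (D (((H * D) ^ m) (i f))) a I = 0 := by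
        refine hh_deg m _ (fun J hJ => ?_) I hI
        rw [LinearMap.proj_apply, cD, extHom_KT_apply, show (fun b => ((H * D) ^ m) (i f) b J) = 0 from
          funext fun b => ih b J hJ, map_zero, Pi.zero_apply]
      rw [this, smul_zero]
  have hnil : (H * D) ^ (n + 1) = 0 := LinearMap.ext fun f => funext fun a => funext fun I =>
    hlow _ f a I (by simpa [Nat.lt_succ_iff] using Finset.card_le_univ I)
  have hσinf : σinf = (∑ m ∈ Finset.range (n + 1), (H * D) ^ m) ∘ₗ i := by
    refine LinearMap.ext fun f => ?_
    simp only [σinf, LinearMap.sum_apply, LinearMap.comp_apply]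
    rfl
  have hψ : ψ = (epsX R par n).restrictScalars S ∘ₗ ((H * D) ^ n) ∘ₗ i := by
    refine LinearMap.ext fun f => ?_
    change epsX R par n (σinf f) = epsX R par n (((H * D) ^ n) (i f))
    rw [hσinf, LinearMap.comp_apply, LinearMap.sum_apply, Finset.sum_range_succ, map_add, map_sum,
      Finset.sum_eq_zero, zero_add]
    intro m hm
    rw [epsX, LinearMap.comp_apply]
    convert map_zero (gX R par ^ n)
    ext a
    refine hpure m f a Finset.univ ?_
    have := Finset.mem_range.1 hm
    simp only [Finset.card_univ, Fintype.card_fin]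
    omega
  set P : Module.End R (ι → R) := (List.ofFn lam).prod with hP
  have hlen : (List.ofFn lam).length = n := List.length_ofFn
  have hGP : gX R par * P = (-1 : R) ^ n • (P * gX R par) := by
    conv_rhs => rw [← hlen]
    refine list_prod_anticomm R fun x hx => ?_
    obtain ⟨j, rfl⟩ := (List.mem_ofFn' _ _).1 hx
    rw [hlam_odd, neg_neg]
  have hθ : ∀ x, θ x = (-1 : R) ^ n • extHom Q P
      (evExt R (Submodule.mkQ (Ideal.span (Set.range u))) x) := fun x => by
    have h1 := LinearMap.congr_fun (extHom_comp_evExt P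
      (Submodule.mkQ (Ideal.span (Set.range u)))) x
    rw [extHom_self] at h1
    exact (map_smul (evExt R (Submodule.mkQ _)) _ (P x)).trans (congrArg _ h1.symm)
  have hDP : extHom Q d * extHom Q P = (-1 : R) ^ n • (extHom Q P * extHom Q d) := by
    have h1 : ∀ x ∈ (List.ofFn lam).map (extHom Q), extHom Q d * x = -(x * extHom Q d) := by
      intro x hx
      obtain ⟨y, hy, rfl⟩ := List.mem_map.1 hx
      obtain ⟨j, rfl⟩ := (List.mem_ofFn' _ _).1 hy
      rw [eq_neg_iff_add_eq_zero, ← map_mul, ← map_mul, ← map_add, add_comm, hlam, map_smul,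
        map_one]
      refine LinearMap.ext fun f => funext fun a => ?_
      obtain ⟨r, hr⟩ := Submodule.Quotient.mk_surjective _ (f a)
      change u j • f a = 0
      rw [← hr, ← Submodule.Quotient.mk_smul, Submodule.Quotient.mk_eq_zero]
      exact Ideal.mul_mem_right _ _ (Ideal.subset_span ⟨j, rfl⟩)
    have h2 := list_prod_anticomm R h1
    rwa [← map_list_prod, List.length_map, hlen] at h2
  have hGP' : extHom Q (gX R par) * extHom Q P =
      (-1 : R) ^ n • (extHom Q P * extHom Q (gX R par)) := by
    rw [← map_mul, hGP, map_smul, map_mul]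
  have hθcomm : ∀ e : Module.End R (ι → R),
      extHom Q e * extHom Q P = (-1 : R) ^ n • (extHom Q P * extHom Q e) →
      ∀ x, extHom Q e (θ x) = θ (((-1 : R) ^ n • e) x) := fun e he x => by
    have h1 := LinearMap.congr_fun (extHom_comp_evExt e
      (Submodule.mkQ (Ideal.span (Set.range u)))) x
    have h2 := LinearMap.congr_fun he (evExt R (Submodule.mkQ (Ideal.span (Set.range u))) x)
    rw [extHom_self, LinearMap.comp_apply, LinearMap.comp_apply] at h1
    rw [LinearMap.smul_apply, Module.End.mul_apply, Module.End.mul_apply, h1] at h2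
    rw [hθ, map_smul, h2, LinearMap.smul_apply, map_smul θ, hθ]
  have hGQ : ∀ f, GQ f = extHom Q (gX R par) f := fun f => oddExt_apply par _ f
  have hεD : ∀ f, epsX R par n (D f) = (-1 : R) ^ n • d (epsX R par n f) := fun f =>
    LinearMap.congr_fun (epsX_comp_extHom hd_odd) f
  have hεδ : ∀ f, epsX R par n (δ f) = 0 := epsX_delK par u
  have hεG : ∀ f, epsX R par n (G f) = gX R par (epsX R par n f) := fun f => by
    have h1 : epsX R par n = (gX R par ^ n) ∘ₗ evExt R (LinearMap.proj Finset.univ) := rfl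
    rw [h1, LinearMap.comp_apply, LinearMap.comp_apply, hG, evExt_extHom_gX, extHom_self,
      ← Module.End.mul_apply, ← Module.End.mul_apply, ← pow_succ, ← pow_succ']
  have hchain := perturbation_inclusion hnil hHH hHi hqH hqi hδi hqd hδd hdd hp
  have hhtpy := perturbation_homotopy (p := i ∘ₗ q) hnil hHH
    (by
      refine LinearMap.ext fun f => ?_
      have h1 := LinearMap.congr_fun hqd (H f)
      have h2 : q (H f) = 0 := LinearMap.congr_fun hqH f
      simp only [LinearMap.comp_apply, h2, map_zero] at h1
      simp only [Module.End.mul_apply, LinearMap.comp_apply, h1, map_zero, LinearMap.zero_apply])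
    hδd hdd hp
  rw [← hσinf] at hchain
  set T := ∑ m ∈ Finset.range (n + 1), (H * D) ^ m with hT
  refine ⟨?_, ?_, ?_, ?_, ?_, ?_⟩
  · exact LinearMap.ext fun x => (hGQ (θ x)).trans (hθcomm _ hGP' x)
  · exact LinearMap.ext (hθcomm d hDP)
  · refine LinearMap.ext fun f => ?_
    have hAG : (G.restrictScalars S) * (H * D) = -((H * D) * (G.restrictScalars S)) :=
      LinearMap.ext fun f => by
        change G (H (D f)) = -(H (D (G f)))
        rw [cDG, map_neg, cHG, neg_neg]
    have h1 := LinearMap.congr_fun (pow_anticomm S hAG n) (i f)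
    have h2 : G (i f) = i (extHom Q (gX R par) f) := (evExt_extHom_gX par σ f).symm
    have h3 : G (((H * D) ^ n) (i f)) = (-1 : S) ^ n • ((H * D) ^ n) (G (i f)) := h1
    rw [hψ]
    change (-1 : R) ^ n • gX R par (epsX R par n (((H * D) ^ n) (i f))) =
      epsX R par n (((H * D) ^ n) (i (GQ f)))
    rw [hGQ, ← h2, ← hεG, h3]
    rcases Nat.even_or_odd n with hn | hn <;> simp [hn.neg_one_pow]
  · refine LinearMap.ext fun f => ?_
    have h1 : D (σinf f) + δ (σinf f) = σinf (DQ f) := LinearMap.congr_fun hchain f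
    change (-1 : R) ^ n • d (epsX R par n (σinf f)) = epsX R par n (σinf (DQ f))
    rw [← h1, map_add, hεδ, add_zero, hεD]
  · set B : Fin n → Module.End R (ι → KT R n) := fun j => wedgeSub n par (lam j) j with hB
    set ϑ : (ι → R) →ₗ[R] (ι → KT R n) :=
      ((List.finRange n).map B).prod ∘ₗ evExt R (unitK R n) with hϑ
    have hqϑ : ∀ x, q (ϑ x) = θ x := fun x => by
      have h1 := augK_wedgeSub_prod par u lam (List.finRange n) x
      rw [List.length_finRange, ← List.ofFn_eq_map (f := lam)] at h1
      exact h1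
    have hεϑ : ∀ x, epsX R par n (ϑ x) = x := fun x => by
      have h1 := (wedgeSub_prod_apply par lam (List.pairwise_lt_finRange n) x).2
      rw [List.length_finRange, List.toFinset_finRange] at h1
      change (gX R par ^ n) (fun a => ϑ x a Finset.univ) = x
      rw [show (fun a => ϑ x a Finset.univ) = (gX R par ^ n) x from h1, ← Module.End.mul_apply,
        ← (Commute.refl (gX R par)).mul_pow, gX_mul_self, one_pow, Module.End.one_apply]
    have hDϑ : ∀ x, (D + δ) (ϑ x) = (-1 : R) ^ n • ϑ (d x) := fun x => by
      have h1 := list_prod_anticomm R (l := (List.finRange n).map B) (d := koszulDiff par d u)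
        fun y hy => by
          obtain ⟨j, -, rfl⟩ := List.mem_map.1 hy
          exact koszulDiff_mul_wedgeSub hd_odd (hlam_odd j) (hlam j)
      rw [List.length_map, List.length_finRange] at h1
      have h2 := LinearMap.congr_fun h1 (evExt R (unitK R n) x)
      rw [Module.End.mul_apply, LinearMap.smul_apply, Module.End.mul_apply,
        koszulDiff_single] at h2
      exact h2
    refine ⟨(epsX R par n).restrictScalars S ∘ₗ (T * H) ∘ₗ ϑ.restrictScalars S,
      LinearMap.ext fun x => ?_⟩
    have h1 : T (i (q (ϑ x))) - ϑ x = (D (T (H (ϑ x))) + δ (T (H (ϑ x)))) +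
        T (H ((D + δ) (ϑ x))) := LinearMap.congr_fun hhtpy (ϑ x)
    have h2 := congrArg (epsX R par n) h1
    rw [map_sub, hqϑ, hεϑ, map_add, map_add, hεδ, add_zero, hεD, hDϑ, ← map_smul ϑ] at h2
    rw [LinearMap.sub_apply, LinearMap.comp_apply]
    change epsX R par n (σinf (θ x)) - x = _
    rw [hσinf]
    exact h2
  · rw [hψ]
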